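/- arXiv:1603.00963 — 4 statements merged into one kernel-verified Lean document; each statement's English description precedes it below -/
import Mathlib

section
/- Let E be a real inner product space with the metric d induced by its norm, and let A, B, C, D ∈ E with d(B,C) > 0. Then (|d(A,B) − d(B,C)| · |d(B,C) − d(C,D)| − d(A,B) · d(C,D)) / d(B,C) ≤ d(A,D). -/
/-- Side-only Ptolemy-based lower bound in a real inner product space:
`(|d(A,B) − d(B,C)| · |d(B,C) − d(C,D)| − d(A,B)·d(C,D)) / d(B,C) ≤ d(A,D)`. -/
theorem ptolemy_side_lower_bound {E : Type*} [NormedAddCommGroup E] [InnerProductSpace ℝ E]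
    (A B C D : E) (hBC : 0 < dist B C) :
    (|dist A B - dist B C| * |dist B C - dist C D| - dist A B * dist C D) / dist B C ≤
      dist A D := by
  have hptolemy := EuclideanGeometry.mul_dist_le_mul_dist_add_mul_dist A B C D
  have hAC : |dist A B - dist B C| ≤ dist A C := by
    simpa only [dist_comm C B] using abs_dist_sub_le A C B
  have hBD : |dist B C - dist C D| ≤ dist B D := by
    simpa only [dist_comm D C] using abs_dist_sub_le B D C
  have hdiagonals := mul_le_mul hAC hBD (abs_nonneg _) dist_nonneg
  rw [div_le_iff₀ hBC]
  linarith
end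

section
/- Let (X, d) be a metric space and let v, t, l₁, l₂ ∈ X. Define the dual landmark heuristic values h₁ = |d(v,l₁) − d(l₁,l₂)| − d(l₂,t), h₂ = |d(v,l₁) − d(l₂,t)| − d(l₁,l₂), h₃ = |d(l₁,l₂) − d(l₂,t)| − d(v,l₁), h₄ = |d(v,l₁) − d(l₁,t)|, and h₅ = |d(v,l₂) − d(l₂,t)|. Then max{h₁, h₂, h₃, h₄, h₅} ≤ d(v,t); that is, the dual landmark heuristic π_t^{DL}(v) never overestimates the distance from v to t (Theorem 1, Admissibility). -/
/-- Admissibility (Theorem 1): the dual landmark heuristic, the maximum of the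
five estimates h₁,…,h₅, never overestimates `d(v,t)` in a metric space. -/
theorem dual_landmark_admissible {X : Type*} [MetricSpace X] (v t l₁ l₂ : X) :
    max (max (max (|dist v l₁ - dist l₁ l₂| - dist l₂ t)
          (|dist v l₁ - dist l₂ t| - dist l₁ l₂))
        (max (|dist l₁ l₂ - dist l₂ t| - dist v l₁)
          (|dist v l₁ - dist l₁ t|)))
      (|dist v l₂ - dist l₂ t|) ≤ dist v t := by
  have h_v_l₁ := dist_triangle4 v t l₂ l₁
  have h_l₁_l₂ := dist_triangle4 l₁ v t l₂
  have h_l₂_t := dist_triangle4 l₂ l₁ v t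
  rw [dist_comm t l₂, dist_comm l₂ l₁] at h_v_l₁
  rw [dist_comm l₁ v, dist_comm t l₂] at h_l₁_l₂
  rw [dist_comm l₂ l₁, dist_comm l₁ v] at h_l₂_t
  have h_l₁ := abs_dist_sub_le v t l₁
  have h_l₂ := abs_dist_sub_le v t l₂
  rw [dist_comm t l₁] at h_l₁
  rw [dist_comm t l₂] at h_l₂
  refine max_le (max_le (max_le ?_ ?_) (max_le ?_ h_l₁)) h_l₂ <;>
    rw [sub_le_iff_le_add, abs_sub_le_iff] <;>
    constructor <;> linarith
end

section
/- Let E be a real inner product space with the metric d induced by its norm, and let v, t, l₁, l₂ ∈ E with d(l₁,l₂) > 0. Define h₁ = |d(v,l₁) − d(l₁,l₂)| − d(l₂,t), h₂ = |d(v,l₁) − d(l₂,t)| − d(l₁,l₂), h₃ = |d(l₁,l₂) − d(l₂,t)| − d(v,l₁), h₄ = |d(v,l₁) − d(l₁,t)|, h₅ = |d(v,l₂) − d(l₂,t)|, and h₆ = (|d(v,l₁) − d(l₁,l₂)| · |d(l₁,l₂) − d(l₂,t)| − d(v,l₁) · d(l₂,t)) / d(l₁,l₂). Then max{h₁, h₂,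 h₃, h₄, h₅, h₆} ≤ d(v,t). -/
/-- Admissibility of the full six-estimate dual landmark heuristic in a
real inner product space. -/
theorem dual_landmark_six_admissible {E : Type*} [NormedAddCommGroup E]
    [InnerProductSpace ℝ E] (v t l₁ l₂ : E) (hl : 0 < dist l₁ l₂) :
    max (max (max (|dist v l₁ - dist l₁ l₂| - dist l₂ t)
          (|dist v l₁ - dist l₂ t| - dist l₁ l₂))
        (max (|dist l₁ l₂ - dist l₂ t| - dist v l₁)
          (|dist v l₁ - dist l₁ t|)))
      (max (|dist v l₂ - dist l₂ t|)
        ((|dist v l₁ - dist l₁ l₂| * |dist l₁ l₂ - dist l₂ t| -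
            dist v l₁ * dist l₂ t) / dist l₁ l₂)) ≤ dist v t := by
  have h_vl₁l₂ : |dist v l₁ - dist l₁ l₂| ≤ dist v l₂ := by
    simpa only [dist_comm l₂ l₁] using abs_dist_sub_le v l₂ l₁
  have h_l₁l₂t : |dist l₁ l₂ - dist l₂ t| ≤ dist l₁ t := by
    simpa only [dist_comm t l₂] using abs_dist_sub_le l₁ t l₂
  have h_vl₁t : |dist v l₁ - dist l₁ t| ≤ dist v t := by
    simpa only [dist_comm t l₁] using abs_dist_sub_le v t l₁
  have h_vl₂t : |dist v l₂ - dist l₂ t| ≤ dist v t := by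
    simpa only [dist_comm t l₂] using abs_dist_sub_le v t l₂
  have ptolemy := EuclideanGeometry.mul_dist_le_mul_dist_add_mul_dist v l₁ l₂ t
  refine max_le (max_le (max_le ?_ ?_) (max_le ?_ h_vl₁t)) (max_le h_vl₂t ?_)
  · linarith [(abs_le.mp h_vl₂t).2]
  · rw [sub_le_iff_le_add, abs_le]
    constructor
    · linarith [(abs_le.mp h_l₁l₂t).1, (abs_le.mp h_vl₁t).1]
    · linarith [(abs_le.mp h_vl₁l₂).2, (abs_le.mp h_vl₂t).2]
  · linarith [(abs_le.mp h_vl₁t).1]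
  · rw [div_le_iff₀ hl]
    linarith [mul_le_mul h_vl₁l₂ h_l₁l₂t (abs_nonneg _) dist_nonneg]
end

section
/- Let (X, d) be a metric space, fix landmarks l₁, l₂, t ∈ X, and define π(v) = max{|d(v,l₁) − d(l₁,l₂)| − d(l₂,t), |d(v,l₁) − d(l₂,t)| − d(l₁,l₂), |d(l₁,l₂) − d(l₂,t)| − d(v,l₁), |d(v,l₁) − d(l₁,t)|, |d(v,l₂) − d(l₂,t)|}. Then for all v, v' ∈ X, π(v) ≤ d(v,v') + π(v'); that is, the dual landmark heuristic is consistent (monotone) over a fixed set of landmarks. -/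
/-- The map `v ↦ |d(v, l) - a|` decreases by at most `d(v, v')` between `v` and `v'`. -/
theorem abs_dist_sub_le_dist_add {X : Type*} [PseudoMetricSpace X] (l v v' : X) (a : ℝ) :
    |dist v l - a| ≤ dist v v' + |dist v' l - a| :=
  (abs_sub_le _ (dist v' l) _).trans (by gcongr; exact abs_dist_sub_le v v' l)


/-- Over a fixed set of landmarks `l₁, l₂` and target `t`, the dual landmark
heuristic `π(v)` is consistent (monotone): `π(v) ≤ d(v,v') + π(v')`. -/
theorem dual_landmark_consistent {X : Type*} [MetricSpace X] (l₁ l₂ t : X)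
    (π : X → ℝ)
    (hπ : ∀ v, π v =
      max (max (max (|dist v l₁ - dist l₁ l₂| - dist l₂ t)
            (|dist v l₁ - dist l₂ t| - dist l₁ l₂))
          (max (|dist l₁ l₂ - dist l₂ t| - dist v l₁)
            (|dist v l₁ - dist l₁ t|)))
        (|dist v l₂ - dist l₂ t|)) :
    ∀ v v' : X, π v ≤ dist v v' + π v' := by
  intro v v'
  have h₁ := fun a => abs_dist_sub_le_dist_add l₁ v v' a
  rw [hπ, hπ]
  simp only [← max_add_add_left]
  refine max_le_max (max_le_max (max_le_max ?_ ?_) (max_le_max ?_ (h₁ _)))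
    (abs_dist_sub_le_dist_add l₂ v v' _)
  · linarith [h₁ (dist l₁ l₂)]
  · linarith [h₁ (dist l₂ t)]
  · linarith [dist_triangle_left v' l₁ v]
end
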